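/- An assignment σ satisfies the clause set {{x,y,u}, {x,y,v}, {x,y,w}, {¬u,¬v,¬w}} (with u,v,w fresh) if and only if σ satisfies {x,y} on the variables x,y together with some choice of values for u,v,w not all true; in particular, for any formula F over variables excluding u,v,w, F ∪ {{x,y}} is satisfiable iff F ∪ {{x,y,u},{x,y,v},{x,y,w},{¬u,¬v,¬w}} is satisfiable. -/

import Mathlib

/-- A literal is a sign together with a variable; `(true, v)` is the positive
literal `v` and `(false, v)` is the negative literal `¬v`. -/
abbrev Lit (V : Type*) := Bool × V

/-- A clause is a finite set of literals. -/
abbrev Clause (V : Type*) := Finset (Lit V)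

/-- An assignment satisfies a clause if it makes at least one literal true. -/
def SatClause {V : Type*} (σ : V → Bool) (C : Clause V) : Prop :=
  ∃ l ∈ C, σ l.2 = l.1

/-- An assignment satisfies a CNF formula (a collection of clauses) if it
satisfies every clause. -/
def Sat {V : Type*} (σ : V → Bool) (F : Set (Clause V)) : Prop :=
  ∀ C ∈ F, SatClause σ C

/-- A formula is satisfiable if some assignment satisfies it. -/
def Satisfiable {V : Type*} (F : Set (Clause V)) : Prop :=
  ∃ σ, Sat σ F

/-- A variable occurs (positively or negatively) in a clause. -/
def VarInClause {V : Type*} (v : V) (C : Clause V) : Prop :=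
  (true, v) ∈ C ∨ (false, v) ∈ C

/-- A variable occurs in a formula. -/
def VarInFormula {V : Type*} (v : V) (F : Set (Clause V)) : Prop :=
  ∃ C ∈ F, VarInClause v C

theorem satClause_congr {V : Type*} {σ τ : V → Bool} {C : Clause V}
    (h : ∀ v, VarInClause v C → σ v = τ v) (hσ : SatClause σ C) : SatClause τ C := by
  obtain ⟨⟨b, v⟩, hl, hv⟩ := hσ
  refine ⟨(b, v), hl, ?_⟩
  rw [← hv]
  exact (h v (by cases b <;> simp [VarInClause, hl])).symm

theorem sat_congr {V : Type*} {σ τ : V → Bool} {F : Set (Clause V)}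
    (h : ∀ v, VarInFormula v F → σ v = τ v) (hσ : Sat σ F) : Sat τ F :=
  fun C hC => satClause_congr (fun v hv => h v ⟨C, hC, hv⟩) (hσ C hC)

theorem sat_union {V : Type*} {σ : V → Bool} {F G : Set (Clause V)} :
    Sat σ (F ∪ G) ↔ Sat σ F ∧ Sat σ G := by
  simp [Sat, or_imp, forall_and]

/-- **Li's rule R₁.** An assignment satisfies
`{{x,y,u}, {x,y,v}, {x,y,w}, {¬u,¬v,¬w}}` (with `u, v, w` fresh and pairwise
distinct) iff it satisfies `{x,y}` and the values of `u, v, w` are not all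
true; consequently, for any formula `F` over variables excluding `u, v, w`,
`F ∪ {{x,y}}` is satisfiable iff
`F ∪ {{x,y,u}, {x,y,v}, {x,y,w}, {¬u,¬v,¬w}}` is satisfiable. -/
theorem li_rule_R1 {V : Type*} [DecidableEq V]
    (F : Set (Clause V)) (x y u v w : V)
    (huv : u ≠ v) (huw : u ≠ w) (hvw : v ≠ w)
    (hux : u ≠ x) (huy : u ≠ y) (hvx : v ≠ x) (hvy : v ≠ y)
    (hwx : w ≠ x) (hwy : w ≠ y)
    (huF : ¬ VarInFormula u F) (hvF : ¬ VarInFormula v F)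
    (hwF : ¬ VarInFormula w F) :
    (∀ σ : V → Bool,
      Sat σ {({(true, x), (true, y), (true, u)} : Clause V),
        {(true, x), (true, y), (true, v)},
        {(true, x), (true, y), (true, w)},
        {(false, u), (false, v), (false, w)}} ↔
      (SatClause σ {(true, x), (true, y)} ∧
        ¬ (σ u = true ∧ σ v = true ∧ σ w = true))) ∧
    (Satisfiable (F ∪ {({(true, x), (true, y)} : Clause V)}) ↔
      Satisfiable (F ∪ {({(true, x), (true, y), (true, u)} : Clause V),
        {(true, x), (true, y), (true, v)},
        {(true, x), (true, y), (true, w)},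
        {(false, u), (false, v), (false, w)}})) := by
  have key : ∀ σ : V → Bool,
      Sat σ {({(true, x), (true, y), (true, u)} : Clause V),
        {(true, x), (true, y), (true, v)},
        {(true, x), (true, y), (true, w)},
        {(false, u), (false, v), (false, w)}} ↔
      (SatClause σ {(true, x), (true, y)} ∧
        ¬ (σ u = true ∧ σ v = true ∧ σ w = true)) := by
    intro σ
    simp only [Sat, SatClause, Set.mem_insert_iff, Set.mem_singleton_iff, forall_eq_or_imp,
      forall_eq, Finset.mem_insert, Finset.mem_singleton, exists_eq_or_imp, exists_eq_left]
    cases σ x <;> cases σ y <;> cases σ u <;> cases σ v <;> cases σ w <;> simp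
  refine ⟨key, ?_, ?_⟩
  · rintro ⟨σ, hσ⟩
    obtain ⟨hF, hxy⟩ := sat_union.1 hσ
    refine ⟨Function.update σ u false, sat_union.2 ⟨sat_congr (fun z hz => ?_) hF, (key _).2 ⟨?_, ?_⟩⟩⟩
    · rw [Function.update_of_ne]
      rintro rfl
      exact huF hz
    · refine satClause_congr (fun z hz => ?_) (hxy _ rfl)
      rw [Function.update_of_ne]
      rintro rfl
      simp [VarInClause, hux, huy] at hz
    · simp
  · rintro ⟨σ, hσ⟩
    obtain ⟨hF, hG⟩ := sat_union.1 hσ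
    refine ⟨σ, sat_union.2 ⟨hF, ?_⟩⟩
    rintro C rfl
    exact ((key σ).1 hG).1
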